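/- Let r ≥ 2 and let n = (r+1)^2, r+1 ≤ k ≤ r^2. Define f(x) = x(r+1) − x^2/4 if x is even and f(x) = x(r+1) − (x^2−1)/4 if x is odd, and μ_k = max{x ∈ {0,…,2r+1} : f(x) − x ≤ k−1}. If q is a prime power with q > C(n, k+μ_k), then there exist vectors x_{i,j} ∈ F_q^k (1 ≤ i, j ≤ r+1) satisfying Σ_{i=1}^{r+1} x_{i,j} = 0 for every j and Σ_{j=1}^{r+1} x_{i,j} = 0 for every i, such that the linear code with these (r+1)^2 columns as generator columns has dimension k and minimum Hamming distance d ≥ n − k + 1 − μ_k. -/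

import Mathlib

open Module in
/-- A vector space over a finite field `F` is not covered by fewer than `|F|` proper subspaces. -/
theorem exists_forall_notMem_of_card_lt {F V ι : Type*} [Field F] [Fintype F] [AddCommGroup V]
    [Module F V] [FiniteDimensional F V] (s : Finset ι) (p : ι → Submodule F V)
    (hs : s.card < Fintype.card F) (hp : ∀ i ∈ s, finrank F (p i) < finrank F V) :
    ∃ v, ∀ i ∈ s, v ∉ p i := by
  classical
  have : Finite V := Module.finite_of_finite F
  have := Fintype.ofFinite V
  by_contra! h
  obtain rfl | hne := s.eq_empty_or_nonempty
  · simpa using h 0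
  obtain ⟨i₀, hi₀⟩ := hne
  obtain ⟨d, hd⟩ : ∃ d, finrank F V = d + 1 := ⟨finrank F V - 1, by have := hp i₀ hi₀; omega⟩
  have hq : 0 < Fintype.card F := Fintype.card_pos
  have hsub : (Finset.univ : Finset V) ⊆ s.biUnion fun i => Finset.univ.filter (· ∈ p i) := by
    intro v _
    obtain ⟨i, hi, hv⟩ := h v
    simpa using ⟨i, hi, hv⟩
  have hcard := Finset.card_le_card hsub
  have hle : ∀ i ∈ s, (Finset.univ.filter (· ∈ p i)).card ≤ Fintype.card F ^ d := by
    intro i hi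
    rw [← Fintype.card_subtype, card_eq_pow_finrank (K := F) (V := p i)]
    have := hp i hi
    exact Nat.pow_le_pow_right hq (by omega)
  have h1 := hcard.trans (Finset.card_biUnion_le_card_mul _ _ _ hle)
  rw [Finset.card_univ, card_eq_pow_finrank (K := F) (V := V), hd, pow_succ, mul_comm] at h1
  exact (Nat.mul_lt_mul_of_pos_right hs (pow_pos hq d)).not_ge h1

open Module in
/-- Over a large enough finite field there are `k` vectors none of whose nontrivial linear
combinations meets any of the given subspaces of codimension at least `k`. -/
theorem exists_forall_sum_smul_notMem {F V ι : Type*} [Field F] [Fintype F] [AddCommGroup V]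
    [Module F V] [FiniteDimensional F V] (s : Finset ι) (p : ι → Submodule F V)
    (hs : s.card < Fintype.card F) (k : ℕ) (hp : ∀ i ∈ s, finrank F (p i) + k ≤ finrank F V) :
    ∃ u : Fin k → V, ∀ y : Fin k → F, y ≠ 0 → ∀ i ∈ s, ∑ t, y t • u t ∉ p i := by
  induction k with
  | zero => exact ⟨0, fun y hy => absurd (Subsingleton.elim y 0) hy⟩
  | succ k ih =>
    obtain ⟨u, hu⟩ := ih fun i hi => by have := hp i hi; omega
    obtain ⟨v, hv⟩ := exists_forall_notMem_of_card_lt s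
      (fun i => Submodule.span F (Set.range u) ⊔ p i) hs fun i hi => by
        have h1 := Submodule.finrank_add_le_finrank_add_finrank
          (Submodule.span F (Set.range u)) (p i)
        have h2 : finrank F (Submodule.span F (Set.range u)) ≤ Fintype.card (Fin k) :=
          finrank_range_le_card u
        rw [Fintype.card_fin] at h2
        have := hp i hi
        omega
    refine ⟨Fin.cons v u, fun y hy i hi hmem => ?_⟩
    simp only [Fin.sum_univ_succ, Fin.cons_zero, Fin.cons_succ] at hmem
    by_cases h0 : y 0 = 0
    · refine hu (fun t => y t.succ) (fun hz => hy ?_) i hi (by simpa [h0] using hmem)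
      funext t
      exact Fin.cases h0 (fun t => congrFun hz t) t
    · refine hv i hi ?_
      have hspan : ∑ t : Fin k, y t.succ • u t ∈ Submodule.span F (Set.range u) :=
        Submodule.sum_mem _ fun t _ =>
          Submodule.smul_mem _ _ (Submodule.subset_span (Set.mem_range_self t))
      have h1 : y 0 • v ∈ Submodule.span F (Set.range u) ⊔ p i := by
        have := Submodule.sub_mem _
          (Submodule.mem_sup_right (S := Submodule.span F (Set.range u)) hmem)
          (Submodule.mem_sup_left hspan)
        simpa using this
      exact (Submodule.smul_mem_iff _ h0).1 h1

/-- The convex function `t ↦ ⌊(t + 1)² / 4⌋` vanishes at `0`, so it is superadditive. -/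
theorem sum_succ_sq_div_four_le {ι : Type*} (s : Finset ι) (t : ι → ℕ) :
    ∑ i ∈ s, (t i + 1) ^ 2 / 4 ≤ (∑ i ∈ s, t i + 1) ^ 2 / 4 := by
  classical
  induction s using Finset.induction_on with
  | empty => simp
  | insert a s ha ih =>
    rw [Finset.sum_insert ha, Finset.sum_insert ha]
    refine (Nat.add_le_add_left ih _).trans ?_
    generalize ∑ i ∈ s, t i = w
    generalize t a = v
    obtain rfl | hv := Nat.eq_zero_or_pos v
    · simp
    obtain rfl | hw := Nat.eq_zero_or_pos w
    · simp
    refine Nat.div_add_div_le_add_div.trans (Nat.div_le_div_right ?_)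
    nlinarith [Nat.mul_le_mul hv hw]

/-- If the values of `a` and `b` together exhaust `C`, then the pairs on which they agree number at
most `⌊(|I| + |J| - |C| + 1)² / 4⌋`. -/
theorem card_agreeing_pairs_le {I J C : Type*} [Fintype I] [Fintype J] [Fintype C] [DecidableEq C]
    (a : I → C) (b : J → C) (h : ∀ c, (∃ i, a i = c) ∨ ∃ j, b j = c) :
    (Finset.univ.filter fun p : I × J => a p.1 = b p.2).card ≤
      (Fintype.card I + Fintype.card J - Fintype.card C + 1) ^ 2 / 4 := by
  classical
  set α : C → ℕ := fun c => (Finset.univ.filter fun i => a i = c).card with hα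
  set β : C → ℕ := fun c => (Finset.univ.filter fun j => b j = c).card with hβ
  have hpos : ∀ c, 1 ≤ α c + β c := by
    intro c
    rcases h c with ⟨i, hi⟩ | ⟨j, hj⟩
    · have : 0 < α c := Finset.card_pos.2 ⟨i, by simpa using hi⟩
      omega
    · have : 0 < β c := Finset.card_pos.2 ⟨j, by simpa using hj⟩
      omega
  have hsα : ∑ c, α c = Fintype.card I :=
    (Finset.card_eq_sum_card_fiberwise (f := a) (t := Finset.univ) (by simp)).symm
  have hsβ : ∑ c, β c = Fintype.card J :=
    (Finset.card_eq_sum_card_fiberwise (f := b) (t := Finset.univ) (by simp)).symm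
  have hprod : (Finset.univ.filter fun p : I × J => a p.1 = b p.2).card = ∑ c, α c * β c := by
    rw [Finset.card_eq_sum_card_fiberwise (f := fun p : I × J => a p.1) (t := Finset.univ) (by simp)]
    refine Finset.sum_congr rfl fun c _ => ?_
    rw [hα, hβ, ← Finset.card_product]
    congr 1
    ext p
    simp only [Finset.mem_filter, Finset.mem_univ, true_and, Finset.mem_product]
    grind
  have hsum : ∑ c, (α c + β c - 1) = Fintype.card I + Fintype.card J - Fintype.card C := by
    have : ∑ c, (α c + β c - 1) + Fintype.card C = ∑ c, (α c + β c) := by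
      rw [Fintype.card_eq_sum_ones, ← Finset.sum_add_distrib]
      exact Finset.sum_congr rfl fun c _ => Nat.sub_add_cancel (hpos c)
    rw [Finset.sum_add_distrib, hsα, hsβ] at this
    omega
  rw [hprod, ← hsum]
  refine le_trans (Finset.sum_le_sum fun c _ => ?_) (sum_succ_sq_div_four_le _ _)
  rw [Nat.sub_add_cancel (hpos c), Nat.le_div_iff_mul_le (by norm_num)]
  zify
  nlinarith [sq_nonneg ((α c : ℤ) - β c)]

section Bipartite

variable {F I J : Type*} [Field F] [DecidableEq I] [DecidableEq J]

/-- The constraint matrix whose left kernel consists of the `w : I × J → F` with vanishing row and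
column sums (the latter negated) that vanish on `S`. -/
def zeroSumMatrix (F : Type*) [Field F] (S : Finset (I × J)) : Matrix (I × J) ((I ⊕ J) ⊕ S) F :=
  fun p => Sum.elim (Sum.elim (fun i => if p.1 = i then 1 else 0) fun j => if p.2 = j then -1 else 0)
    fun s => if p = s then 1 else 0

variable [Fintype I] [Fintype J]

theorem transpose_zeroSumMatrix_mulVec_eq_zero {S : Finset (I × J)} {w : I × J → F} :
    (zeroSumMatrix F S).transpose.mulVec w = 0 ↔
      (∀ i, ∑ j, w (i, j) = 0) ∧ (∀ j, ∑ i, w (i, j) = 0) ∧ ∀ p ∈ S, w p = 0 := by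
  simp [funext_iff, Matrix.mulVec, dotProduct, zeroSumMatrix, Fintype.sum_prod_type,
    and_assoc, Prod.ext_iff, ite_and]

theorem zeroSumMatrix_mulVec {S : Finset (I × J)} (h : (I ⊕ J) ⊕ S → F) (p : I × J) :
    (zeroSumMatrix F S).mulVec h p =
      h (.inl (.inl p.1)) - h (.inl (.inr p.2)) + ∑ s : S, if p = s then h (.inr s) else 0 := by
  simp [Matrix.mulVec, dotProduct, zeroSumMatrix, sub_eq_add_neg]

open Module in
theorem finrank_ker_transpose_zeroSumMatrix (S : Finset (I × J)) :
    finrank F (LinearMap.ker (zeroSumMatrix F S).transpose.mulVecLin) +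
        (Fintype.card I + Fintype.card J + S.card) =
      Fintype.card I * Fintype.card J + finrank F (LinearMap.ker (zeroSumMatrix F S).mulVecLin) := by
  have h1 := (zeroSumMatrix F S).transpose.mulVecLin.finrank_range_add_finrank_ker
  have h2 := (zeroSumMatrix F S).mulVecLin.finrank_range_add_finrank_ker
  have h3 := (zeroSumMatrix F S).rank_transpose
  rw [Matrix.rank, Matrix.rank] at h3
  simp only [finrank_fintype_fun_eq_card, Fintype.card_prod, Fintype.card_sum,
    Fintype.card_coe] at h1 h2
  omega

/-- Adjacency, from left to right, in the bipartite graph on `I ⊕ J` whose non-edges are `S`. -/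
def complRel (S : Finset (I × J)) (u v : I ⊕ J) : Prop :=
  ∃ p ∉ S, u = .inl p.1 ∧ v = .inr p.2

open Module in
theorem finrank_ker_zeroSumMatrix_le (S : Finset (I × J)) :
    finrank F (LinearMap.ker (zeroSumMatrix F S).mulVecLin) ≤ Nat.card (Quot (complRel S)) := by
  have : Finite (Quot (complRel S)) := Finite.of_surjective _ Quot.mk_surjective
  have := Fintype.ofFinite (Quot (complRel S))
  let φ : LinearMap.ker (zeroSumMatrix F S).mulVecLin →ₗ[F] (Quot (complRel S) → F) :=
    LinearMap.funLeft F F (fun c : Quot (complRel S) => (.inl c.out : (I ⊕ J) ⊕ S)) ∘ₗ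
      Submodule.subtype _
  have hφ : Function.Injective φ := by
    rw [injective_iff_map_eq_zero]
    rintro ⟨h, hh⟩ h0
    have hh' : ∀ p, (zeroSumMatrix F S).mulVec h p = 0 := fun p => congrFun hh p
    simp only [zeroSumMatrix_mulVec] at hh'
    have hl : ∀ v, h (.inl v) = 0 := by
      intro v
      have hrel : ∀ u v, complRel S u v → h (.inl u) = h (.inl v) := by
        rintro _ _ ⟨p, hp, rfl, rfl⟩
        have := hh' p
        rw [Finset.sum_eq_zero fun s _ => if_neg (ne_of_mem_of_not_mem s.2 hp).symm,
          add_zero] at this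
        exact sub_eq_zero.1 this
      have h1 : h (.inl (Quot.mk (complRel S) v).out) = 0 := congrFun h0 (Quot.mk _ v)
      have h2 := congrArg (Quot.lift (fun u => h (.inl u)) hrel)
        (Quot.out_eq (Quot.mk (complRel S) v))
      exact h2.symm.trans h1
    ext x
    rcases x with v | s
    · exact hl v
    · simpa [hl] using hh' s
  rw [Nat.card_eq_fintype_card, ← finrank_fintype_fun_eq_card F]
  exact LinearMap.finrank_le_finrank_of_injective hφ

/-- A bipartite graph with `c` components has at most `⌊(|I| + |J| - c + 1)² / 4⌋` edges. -/
theorem card_compl_le (S : Finset (I × J)) :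
    Fintype.card I * Fintype.card J - S.card ≤
      (Fintype.card I + Fintype.card J - Nat.card (Quot (complRel S)) + 1) ^ 2 / 4 := by
  classical
  have : Finite (Quot (complRel S)) := Finite.of_surjective _ Quot.mk_surjective
  have := Fintype.ofFinite (Quot (complRel S))
  rw [Nat.card_eq_fintype_card]
  refine le_trans ?_ (card_agreeing_pairs_le (fun i : I => Quot.mk (complRel S) (.inl i))
    (fun j : J => Quot.mk (complRel S) (.inr j)) ?_)
  · rw [← Fintype.card_prod, ← Finset.card_compl]
    refine Finset.card_le_card fun p hp => ?_
    simpa using Quot.sound ⟨p, by simpa using hp, rfl, rfl⟩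
  · rintro ⟨i | j⟩
    exacts [.inl ⟨i, rfl⟩, .inr ⟨j, rfl⟩]

open Module in
theorem le_finrank_ker_transpose_zeroSumMatrix [Nonempty I] :
    Fintype.card I * Fintype.card J + 1 ≤
      finrank F (LinearMap.ker (zeroSumMatrix F (∅ : Finset (I × J))).transpose.mulVecLin) +
        (Fintype.card I + Fintype.card J) := by
  have h := finrank_ker_transpose_zeroSumMatrix (F := F) (∅ : Finset (I × J))
  rw [Finset.card_empty, add_zero] at h
  rw [h]
  refine Nat.add_le_add_left (Nat.one_le_iff_ne_zero.2 fun h0 => ?_) _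
  rw [Submodule.finrank_eq_zero, LinearMap.ker_eq_bot'] at h0
  have := h0 1 (by ext p; simp [zeroSumMatrix_mulVec])
  simpa using congrFun this (.inl (.inl (Classical.arbitrary I)))

end Bipartite

open Module in
theorem finrank_ker_transpose_zeroSumMatrix_le {m k μ : ℕ} (hk : 0 < k) (F : Type*) [Field F]
    (S : Finset (Fin m × Fin m)) (hS : S.card = k + μ)
    (hμ : ∀ x, μ < x → x < 2 * m → k + x ≤ x * m - x ^ 2 / 4) :
    finrank F (LinearMap.ker (zeroSumMatrix F S).transpose.mulVecLin) + k + 2 * m ≤ m ^ 2 + 1 := by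
  have h1 := finrank_ker_transpose_zeroSumMatrix (F := F) S
  have h2 := finrank_ker_zeroSumMatrix_le (F := F) S
  have h3 := card_compl_le S
  have h4 : Nat.card (Quot (complRel S)) ≤ 2 * m := by
    have := Nat.card_le_card_of_surjective _ (Quot.mk_surjective (r := complRel S))
    simpa [two_mul] using this
  simp only [Fintype.card_fin, hS] at h1 h3
  generalize Nat.card (Quot (complRel S)) = c at *
  suffices h : c ≤ μ + 1 by nlinarith
  by_contra! hc
  obtain ⟨x, rfl⟩ : ∃ x, c = x + 1 := ⟨c - 1, by omega⟩
  have h5 := hμ x (by omega) (by omega)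
  obtain ⟨y, hy⟩ : ∃ y, 2 * m = x + 1 + y := ⟨2 * m - (x + 1), by omega⟩
  have h6 : m + m - (x + 1) + 1 = y + 1 := by omega
  rw [h6] at h3
  have h7 : (y + 1) ^ 2 + 4 * (x * m) = 4 * (m * m) + x ^ 2 := by
    have h8 : y + 1 + x = 2 * m := by omega
    nlinarith
  generalize m * m = A at *
  generalize x * m = B at *
  generalize (y + 1) ^ 2 = C at *
  generalize x ^ 2 = D at *
  omega

/-- Existence of the square code (Example 3): for `n = (r+1)²`, `r+1 ≤ k ≤ r²`
and a field with more than `C(n, k + μ_k)` elements, there exist columns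
`x i j ∈ F^k` with all row sums and column sums zero such that the generated
code has dimension `k` and minimum distance at least `n - k + 1 - μ_k`, where
`μ_k = max {x ∈ {0,…,2r+1} : f(x) - x ≤ k - 1}` and
`f(x) = x(r+1) - x²/4` for even `x`, `f(x) = x(r+1) - (x²-1)/4` for odd `x`. -/
theorem stmt16 (r k : ℕ) (hr : 2 ≤ r) (hk1 : r + 1 ≤ k) (hk2 : k ≤ r ^ 2)
    (n : ℕ) (hn : n = (r + 1) ^ 2)
    (f : ℕ → ℕ)
    (hf : ∀ x, f x = if Even x then x * (r + 1) - x ^ 2 / 4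
                     else x * (r + 1) - (x ^ 2 - 1) / 4)
    (μk : ℕ) (hμk : μk = Nat.findGreatest (fun x => f x - x ≤ k - 1) (2 * r + 1))
    (F : Type*) [Field F] [Fintype F] [DecidableEq F]
    (hq : n.choose (k + μk) < Fintype.card F) :
    ∃ x : Fin (r + 1) → Fin (r + 1) → (Fin k → F),
      -- column sums and row sums are zero
      (∀ j, ∑ i, x i j = 0) ∧
      (∀ i, ∑ j, x i j = 0) ∧
      -- the code has dimension `k`
      Module.finrank F (Submodule.span F
        (Set.range fun p : Fin (r + 1) × Fin (r + 1) => x p.1 p.2)) = k ∧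
      -- minimum Hamming distance at least `n - k + 1 - μ_k`
      (∀ y : Fin k → F, y ≠ 0 →
        n - k + 1 - μk ≤
          hammingNorm (fun p : Fin (r + 1) × Fin (r + 1) => ∑ t, y t * x p.1 p.2 t)) := by
  have hμ : ∀ x, μk < x → x < 2 * (r + 1) → k + x ≤ x * (r + 1) - x ^ 2 / 4 := by
    intro x h1 h2
    have h3 : ¬ f x - x ≤ k - 1 :=
      Nat.findGreatest_is_greatest (P := fun x => f x - x ≤ k - 1) (hμk ▸ h1) (by omega)
    have h4 : f x = x * (r + 1) - x ^ 2 / 4 := by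
      rw [hf]
      split_ifs with he
      · rfl
      · obtain ⟨t, rfl⟩ := Nat.not_even_iff_odd.1 he
        congr 1
        have : (2 * t + 1) ^ 2 = 4 * (t ^ 2 + t) + 1 := by ring
        omega
    omega
  have hμle : μk ≤ 2 * r + 1 := hμk ▸ Nat.findGreatest_le _
  have hkn : k + μk ≤ n := by nlinarith
  set P := Fin (r + 1) × Fin (r + 1)
  have hcardP : Fintype.card P = n := by simp [P, hn, sq]
  let W := LinearMap.ker (zeroSumMatrix F (∅ : Finset P)).transpose.mulVecLin
  have hW : ∀ w : P → F, w ∈ W ↔ (∀ i, ∑ j, w (i, j) = 0) ∧ (∀ j, ∑ i, w (i, j) = 0) := by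
    intro w
    refine LinearMap.mem_ker.trans (transpose_zeroSumMatrix_mulVec_eq_zero.trans ?_)
    simp
  let K : Finset P → Submodule F W := fun S =>
    (LinearMap.ker (zeroSumMatrix F S).transpose.mulVecLin).comap W.subtype
  have hWrank : r ^ 2 ≤ Module.finrank F W := by
    have := le_finrank_ker_transpose_zeroSumMatrix (F := F) (I := Fin (r + 1)) (J := Fin (r + 1))
    simp only [Fintype.card_fin] at this
    change _ ≤ Module.finrank F W + _ at this
    nlinarith
  obtain ⟨u, hu⟩ := exists_forall_sum_smul_notMem (F := F)
    (Finset.powersetCard (k + μk) (Finset.univ : Finset P)) K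
    (by rwa [Finset.card_powersetCard, Finset.card_univ, hcardP]) k fun S hS => by
      have h1 := finrank_ker_transpose_zeroSumMatrix_le (by omega) F S
        (Finset.mem_powersetCard.1 hS).2 hμ
      have h2 : Module.finrank F (K S) ≤
          Module.finrank F (LinearMap.ker (zeroSumMatrix F S).transpose.mulVecLin) := by
        rw [← Submodule.finrank_map_subtype_eq]
        exact Submodule.finrank_mono (Submodule.map_comap_le _ _)
      nlinarith
  have hdist : ∀ y : Fin k → F, y ≠ 0 → n - k + 1 - μk ≤
      hammingNorm (fun p : P => ∑ t, y t * (u t : P → F) p) := by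
    intro y hy
    set w : P → F := fun p => ∑ t, y t * (u t : P → F) p with hw
    have hwW : ((∑ t, y t • u t : W) : P → F) = w := by
      ext p
      simp [hw]
    have hnorm : hammingNorm w + (Finset.univ.filter fun p => w p = 0).card = n := by
      rw [← hcardP, ← Finset.card_univ,
        ← Finset.card_filter_add_card_filter_not (s := Finset.univ) (fun p => w p ≠ 0)]
      simp [hammingNorm]
    by_contra! hlt
    obtain ⟨S, hS, hcard⟩ := Finset.exists_subset_card_eq
      (show k + μk ≤ (Finset.univ.filter fun p => w p = 0).card by omega)
    refine hu y hy S (by simp [hcard]) ?_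
    rw [Submodule.mem_comap, Submodule.subtype_apply, hwW]
    have hmem := (hW w).1 (hwW ▸ (∑ t, y t • u t : W).2)
    exact transpose_zeroSumMatrix_mulVec_eq_zero.2
      ⟨hmem.1, hmem.2, fun p hp => by simpa using hS hp⟩
  refine ⟨fun i j t => (u t : P → F) (i, j), fun j => ?_, fun i => ?_, ?_, hdist⟩
  · ext t
    simpa using ((hW _).1 (u t).2).2 j
  · ext t
    simpa using ((hW _).1 (u t).2).1 i
  · have hli : LinearIndependent F (Matrix.of fun t => (u t : P → F)).row := by
      rw [Fintype.linearIndependent_iff]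
      intro y hy t
      by_contra ht
      have h0 := hdist y fun h => ht (congrFun h t)
      have : (fun p : P => ∑ t, y t * (u t : P → F) p) = 0 := by
        ext p
        simpa using congrFun hy p
      rw [this, hammingNorm_zero] at h0
      omega
    have h1 := hli.rank_matrix
    rw [Matrix.rank_eq_finrank_span_cols, Fintype.card_fin] at h1
    exact h1
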